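/- Let ū : ℝ² → ℝ² be a smooth vector field with bounded derivatives and let φ : ℝ² → ℝ be smooth with compact support. Then ∫_{ℝ²} (ū·∇φ) Δφ dx = − ∫_{ℝ²} ( (∇_S ū − ½ (∇·ū) I₂) ∇φ ) · ∇φ dx, where ∇_S ū := ½(∇ū + (∇ū)ᵀ) is the symmetric part of the Jacobian of ū, ∇·ū its divergence, and I₂ the 2×2 identity matrix. -/

import Mathlib

open MeasureTheory Matrix Set

noncomputable section

/-- The plane `ℝ²` with the Euclidean structure. -/
abbrev E2 := EuclideanSpace ℝ (Fin 2)

/-- Partial derivative `∂ᵢ f` of a scalar function on `ℝ²`. -/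
def pd (i : Fin 2) (f : E2 → ℝ) (x : E2) : ℝ :=
  fderiv ℝ f x (EuclideanSpace.single i 1)

/-- The Laplacian `Δ f = ∂₁∂₁ f + ∂₂∂₂ f`. -/
def lap (f : E2 → ℝ) (x : E2) : ℝ :=
  pd 0 (pd 0 f) x + pd 1 (pd 1 f) x

/-- The rotated gradient `rot ψ = (∂₂ψ, −∂₁ψ)`. -/
def rotv (f : E2 → ℝ) (x : E2) : Fin 2 → ℝ := ![pd 1 f x, -(pd 0 f x)]

/-- The gradient `∇f = (∂₁f, ∂₂f)` as a plain vector. -/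
def grad2 (f : E2 → ℝ) (x : E2) : Fin 2 → ℝ := ![pd 0 f x, pd 1 f x]

/-- The Jacobian matrix `(∇u)ᵢⱼ = ∂ⱼ uᵢ` of a vector field. -/
def gradMat (u : E2 → Fin 2 → ℝ) (x : E2) : Matrix (Fin 2) (Fin 2) ℝ :=
  Matrix.of fun i j => pd j (fun y => u y i) x

/-- The divergence `∇·u = ∂₁u₁ + ∂₂u₂` of a vector field. -/
def divg (u : E2 → Fin 2 → ℝ) (x : E2) : ℝ :=
  pd 0 (fun y => u y 0) x + pd 1 (fun y => u y 1) x

lemma ContDiff.pd {f : E2 → ℝ} (hf : ContDiff ℝ (⊤ : ℕ∞) f) (i : Fin 2) :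
    ContDiff ℝ (⊤ : ℕ∞) (pd i f) :=
  (hf.fderiv_right (m := (⊤ : ℕ∞)) (by simp)).clm_apply contDiff_const

lemma HasCompactSupport.pd {f : E2 → ℝ} (hf : HasCompactSupport f) (i : Fin 2) :
    HasCompactSupport (pd i f) :=
  hf.fderiv_apply ℝ _

lemma pd_add {f g : E2 → ℝ} (hf : Differentiable ℝ f) (hg : Differentiable ℝ g)
    (i : Fin 2) (x : E2) : pd i (fun y => f y + g y) x = pd i f x + pd i g x := by
  simp [pd, fderiv_fun_add (hf x) (hg x)]

lemma pd_sub {f g : E2 → ℝ} (hf : Differentiable ℝ f) (hg : Differentiable ℝ g)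
    (i : Fin 2) (x : E2) : pd i (fun y => f y - g y) x = pd i f x - pd i g x := by
  simp [pd, fderiv_fun_sub (hf x) (hg x)]

lemma pd_mul {f g : E2 → ℝ} (hf : Differentiable ℝ f) (hg : Differentiable ℝ g)
    (i : Fin 2) (x : E2) :
    pd i (fun y => f y * g y) x = f x * pd i g x + g x * pd i f x := by
  simp [pd, fderiv_fun_mul (hf x) (hg x)]

lemma pd_const_mul {f : E2 → ℝ} (hf : Differentiable ℝ f) (c : ℝ) (i : Fin 2) (x : E2) :
    pd i (fun y => c * f y) x = c * pd i f x := by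
  simp [pd, fderiv_const_mul (hf x)]

lemma pd_comm {f : E2 → ℝ} (hf : ContDiff ℝ (⊤ : ℕ∞) f) (i j : Fin 2) (x : E2) :
    pd i (pd j f) x = pd j (pd i f) x := by
  have hd : Differentiable ℝ (fderiv ℝ f) :=
    (hf.fderiv_right (m := (⊤ : ℕ∞)) (by simp)).differentiable (by simp)
  have key : ∀ k l : Fin 2, pd k (pd l f) x
      = fderiv ℝ (fderiv ℝ f) x (EuclideanSpace.single k 1) (EuclideanSpace.single l 1) := by
    intro k l
    change fderiv ℝ (fun y => fderiv ℝ f y (EuclideanSpace.single l 1)) x _ = _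
    rw [fderiv_clm_apply (hd x) (differentiableAt_const _)]
    simp
  rw [key, key]
  have h2 : ((2 : ℕ∞) : WithTop ℕ∞) ≤ ((⊤ : ℕ∞) : WithTop ℕ∞) := WithTop.coe_le_coe.2 le_top
  exact (hf.contDiffAt.isSymmSndFDerivAt (by simpa using h2)).eq _ _

lemma integrable_pd {f : E2 → ℝ} (hf : ContDiff ℝ (⊤ : ℕ∞) f) (hc : HasCompactSupport f)
    (i : Fin 2) : Integrable (pd i f) :=
  (hf.pd i).continuous.integrable_of_hasCompactSupport (hc.pd i)

lemma integral_pd_eq_zero {f : E2 → ℝ} (hf : ContDiff ℝ (⊤ : ℕ∞) f)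
    (hc : HasCompactSupport f) (i : Fin 2) : ∫ x, pd i f x = 0 := by
  have h := integral_mul_fderiv_eq_neg_fderiv_mul_of_integrable (μ := (volume : Measure E2))
    (f := fun _ : E2 => (1 : ℝ)) (g := f) (v := EuclideanSpace.single i 1)
    (by simp) (by simp only [one_mul]; exact integrable_pd hf hc i)
    (by simpa using hf.continuous.integrable_of_hasCompactSupport hc)
    (by fun_prop) (fun x _ => hf.differentiable (by simp) x)
  simpa [pd] using h

/-- The flux `(u·∇φ) ∇φ − ½ |∇φ|² u`. -/
def convectiveFlux (u : E2 → Fin 2 → ℝ) (φ : E2 → ℝ) (j : Fin 2) (x : E2) : ℝ :=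
  (u x 0 * pd 0 φ x + u x 1 * pd 1 φ x) * pd j φ x
    - 1 / 2 * (u x j * (pd 0 φ x * pd 0 φ x + pd 1 φ x * pd 1 φ x))

lemma contDiff_convectiveFlux {u : E2 → Fin 2 → ℝ} (hu : ContDiff ℝ (⊤ : ℕ∞) u)
    {φ : E2 → ℝ} (hφ : ContDiff ℝ (⊤ : ℕ∞) φ) (j : Fin 2) :
    ContDiff ℝ (⊤ : ℕ∞) (convectiveFlux u φ j) := by
  have hu' := contDiff_pi.1 hu
  have hp := hφ.pd
  exact ((((hu' 0).mul (hp 0)).add ((hu' 1).mul (hp 1))).mul (hp j)).sub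
    (contDiff_const.mul ((hu' j).mul (((hp 0).mul (hp 0)).add ((hp 1).mul (hp 1)))))

lemma hasCompactSupport_convectiveFlux (u : E2 → Fin 2 → ℝ) {φ : E2 → ℝ}
    (hφ : HasCompactSupport φ) (j : Fin 2) : HasCompactSupport (convectiveFlux u φ j) :=
  ((hφ.pd j).mul_left).sub
    ((((hφ.pd 0).mul_left).add ((hφ.pd 1).mul_left)).mul_left.mul_left)

lemma pd_convectiveFlux {u : E2 → Fin 2 → ℝ} (hu : ContDiff ℝ (⊤ : ℕ∞) u)
    {φ : E2 → ℝ} (hφ : ContDiff ℝ (⊤ : ℕ∞) φ) (i j : Fin 2) (x : E2) :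
    pd i (convectiveFlux u φ j) x =
      (u x 0 * pd 0 φ x + u x 1 * pd 1 φ x) * pd i (pd j φ) x
      + pd j φ x * (u x 0 * pd i (pd 0 φ) x + pd 0 φ x * pd i (fun y => u y 0) x
        + (u x 1 * pd i (pd 1 φ) x + pd 1 φ x * pd i (fun y => u y 1) x))
      - 1 / 2 * (u x j * (2 * (pd 0 φ x * pd i (pd 0 φ) x + pd 1 φ x * pd i (pd 1 φ) x))
        + (pd 0 φ x * pd 0 φ x + pd 1 φ x * pd 1 φ x) * pd i (fun y => u y j) x) := by
  have hu' : ∀ k, Differentiable ℝ fun y => u y k :=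
    fun k => (contDiff_pi.1 hu k).differentiable (by simp)
  have hp : ∀ k, Differentiable ℝ (pd k φ) := fun k => (hφ.pd k).differentiable (by simp)
  have hA := ((hu' 0).fun_mul (hp 0))
  have hB := ((hu' 1).fun_mul (hp 1))
  have hC := ((hp 0).fun_mul (hp 0))
  have hD := ((hp 1).fun_mul (hp 1))
  unfold convectiveFlux
  rw [pd_sub ((hA.fun_add hB).fun_mul (hp j)) (((hu' j).fun_mul (hC.fun_add hD)).const_mul _),
    pd_mul (hA.fun_add hB) (hp j), pd_add hA hB, pd_mul (hu' 0) (hp 0), pd_mul (hu' 1) (hp 1),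
    pd_const_mul ((hu' j).fun_mul (hC.fun_add hD)), pd_mul (hu' j) (hC.fun_add hD), pd_add hC hD,
    pd_mul (hp 0) (hp 0), pd_mul (hp 1) (hp 1)]
  ring

/-- integration by parts for the convective term:
`∫ (ū·∇φ) Δφ = −∫ ((∇_S ū − ½(∇·ū)I₂)∇φ)·∇φ`. -/
theorem convective_ibp
    (ub : E2 → Fin 2 → ℝ) (hub : ContDiff ℝ (⊤ : ℕ∞) ub)
    (hubD : ∃ C, ∀ (x : E2) (i j : Fin 2), |gradMat ub x i j| ≤ C)
    (φ : E2 → ℝ) (hφ : ContDiff ℝ (⊤ : ℕ∞) φ) (hsupp : HasCompactSupport φ) :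
    ∫ x : E2, (∑ i, ub x i * pd i φ x) * lap φ x
      = - ∫ x : E2,
          ((((1 : ℝ) / 2) • (gradMat ub x + (gradMat ub x)ᵀ)
            - (((1 : ℝ) / 2) * divg ub x) • (1 : Matrix (Fin 2) (Fin 2) ℝ)).mulVec
              (grad2 φ x)) ⬝ᵥ grad2 φ x := by
  have hu' := contDiff_pi.1 hub
  have hF := contDiff_convectiveFlux hub hφ
  have hFc := hasCompactSupport_convectiveFlux ub hsupp
  have hL : Integrable fun x : E2 => (∑ i, ub x i * pd i φ x) * lap φ x := by
    refine Continuous.integrable_of_hasCompactSupport ?_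
      (HasCompactSupport.mul_left (((hsupp.pd 0).pd 0).add ((hsupp.pd 1).pd 1)))
    exact (continuous_finsetSum _ fun i _ => (hu' i).continuous.mul (hφ.pd i).continuous).mul
      (((hφ.pd 0).pd 0).continuous.add ((hφ.pd 1).pd 1).continuous)
  have hdiv : Integrable fun x : E2 =>
      pd 0 (convectiveFlux ub φ 0) x + pd 1 (convectiveFlux ub φ 1) x :=
    (integrable_pd (hF 0) (hFc 0) 0).add (integrable_pd (hF 1) (hFc 1) 1)
  have hdiv0 : ∫ x : E2, (pd 0 (convectiveFlux ub φ 0) x + pd 1 (convectiveFlux ub φ 1) x)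
      = 0 := by
    rw [integral_add (integrable_pd (hF 0) (hFc 0) 0) (integrable_pd (hF 1) (hFc 1) 1),
      integral_pd_eq_zero (hF 0) (hFc 0), integral_pd_eq_zero (hF 1) (hFc 1), add_zero]
  rw [← sub_eq_zero, sub_neg_eq_add, add_comm, ← eq_neg_iff_add_eq_zero, ← zero_sub, ← hdiv0,
    ← integral_sub hdiv hL]
  refine integral_congr_ae (Filter.Eventually.of_forall fun x => ?_)
  simp only [pd_convectiveFlux hub hφ, pd_comm hφ 1 0 x, lap, divg, gradMat, grad2, mulVec,
    dotProduct, Fin.sum_univ_two, Matrix.sub_apply, Matrix.smul_apply, Matrix.add_apply,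
    Matrix.transpose_apply, Matrix.of_apply, Matrix.one_apply, smul_eq_mul, Matrix.cons_val_zero,
    Matrix.cons_val_one]
  simp
  ring
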